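/- Let g = ((A,B),(0,(Aᵀ)^{−1})) ∈ Sp(n,ℝ) with A ∈ GL(n,ℝ) (so that A Bᵀ is symmetric), and define the operator R_g on L²(ℝⁿ) by (R_g f)(w) = |det A|^{1/2} · e(½ w A Bᵀ wᵀ) · f(wA). Then R_g is a unitary operator on L²(ℝⁿ), and for every (x,y,t) in the Heisenberg group H and every f ∈ L²(ℝⁿ): R_g ( W((x,y,t)^g) f ) = W(x,y,t) ( R_g f ), where (x,y,t)^g = (xA, xB + y(Aᵀ)^{−1}, t). -/

import Mathlib

open Matrix MeasureTheory

/-- `e(t) = exp(2πit)`. -/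
noncomputable def eTwoPi (t : ℝ) : ℂ := Complex.exp (2 * Real.pi * Complex.I * t)

/-- The Schrödinger representation: `(W(x,y,t)f)(w) = e(−t + ½xyᵀ + wyᵀ) f(w+x)`. -/
noncomputable def schrodingerW {n : ℕ} (x y : Fin n → ℝ) (t : ℝ)
    (f : (Fin n → ℝ) → ℂ) : (Fin n → ℝ) → ℂ :=
  fun w => eTwoPi (-t + (1 / 2) * (x ⬝ᵥ y) + w ⬝ᵥ y) * f (w + x)

theorem eTwoPi_add (s t : ℝ) : eTwoPi (s + t) = eTwoPi s * eTwoPi t := by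
  simp only [eTwoPi, ← Complex.exp_add]
  push_cast
  ring_nf

theorem norm_eTwoPi (t : ℝ) : ‖eTwoPi t‖ = 1 := by
  have h : (2 * Real.pi * Complex.I * t : ℂ) = ((2 * Real.pi * t : ℝ) : ℂ) * Complex.I := by
    push_cast
    ring
  rw [eTwoPi, h, Complex.norm_exp_ofReal_mul_I]

theorem eTwoPi_ne_zero (t : ℝ) : eTwoPi t ≠ 0 := Complex.exp_ne_zero _

/-- Multiplication by a nowhere vanishing function composed with pullback along a bijection
is a bijection on functions. -/
theorem bijective_mul_comp {α β M : Type*} [GroupWithZero M] (m : α → M) (hm : ∀ a, m a ≠ 0)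
    (e : α ≃ β) : Function.Bijective fun (f : β → M) (a : α) => m a * f (e a) := by
  refine ⟨fun f₁ f₂ h => funext fun b => ?_,
    fun h => ⟨fun b => (m (e.symm b))⁻¹ * h (e.symm b), ?_⟩⟩
  · have := congrFun h (e.symm b)
    simpa [hm] using this
  · funext a
    simp [hm]

/-- The change of variables `w ↦ wA` in the `L²`-norm. -/
theorem eLpNorm_two_comp_vecMul {ι E : Type*} [Fintype ι] [DecidableEq ι] [NormedAddCommGroup E]
    [NormedSpace ℝ E] (A : Matrix ι ι ℝ) (hA : IsUnit A.det) (f : (ι → ℝ) → E) :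
    eLpNorm (fun w => √|A.det| • f (w ᵥ* A)) 2 volume = eLpNorm f 2 volume := by
  have hdet : 0 < |A.det| := abs_pos.mpr hA.ne_zero
  have hemb : MeasurableEmbedding (fun w : ι → ℝ => w ᵥ* A) := by
    refine Continuous.measurableEmbedding (by fun_prop) ?_
    exact Matrix.vecMul_injective_of_isUnit ((Matrix.isUnit_iff_isUnit_det A).mpr hA)
  have hmap : Measure.map (fun w : ι → ℝ => w ᵥ* A) volume
      = ENNReal.ofReal |A.det|⁻¹ • volume := by
    have := Real.map_matrix_volume_pi_eq_smul_volume_pi (M := Aᵀ) (by simpa using hA.ne_zero)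
    have hfun : (fun w : ι → ℝ => w ᵥ* A) = Matrix.toLin' Aᵀ :=
      funext fun w => by rw [Matrix.toLin'_apply, Matrix.mulVec_transpose]
    rw [hfun, this, Matrix.det_transpose, abs_inv]
  have hcomp := hemb.eLpNorm_map_measure (g := f) (p := 2) (μ := volume)
  rw [hmap, eLpNorm_smul_measure_of_ne_top (by norm_num)] at hcomp
  change eLpNorm (√|A.det| • (f ∘ fun w : ι → ℝ => w ᵥ* A)) 2 volume = _
  rw [eLpNorm_const_smul, ← hcomp, smul_eq_mul, ← mul_assoc, Real.enorm_eq_ofReal (by positivity),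
    ENNReal.ofReal_rpow_of_pos (by positivity), ← ENNReal.ofReal_mul (by positivity)]
  have hone : √|A.det| * |A.det|⁻¹ ^ (1 / (2 : ENNReal)).toReal = 1 := by
    have htwo : (1 / (2 : ENNReal)).toReal = 1 / 2 := by simp
    rw [htwo, ← Real.sqrt_eq_rpow, Real.sqrt_inv, mul_inv_cancel₀ (by positivity)]
  rw [hone, ENNReal.ofReal_one, one_mul]

/-- The phases on the two sides of the intertwining relation agree. -/
theorem intertwining_phase_eq {ι R : Type*} [Fintype ι] [DecidableEq ι] [Field R] [CharZero R]
    (A B : Matrix ι ι R) (hA : IsUnit A.det) (hAB : (A * Bᵀ)ᵀ = A * Bᵀ) (x y w : ι → R) (t : R) :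
    1 / 2 * (w ⬝ᵥ (A * Bᵀ) *ᵥ w)
        + (-t + 1 / 2 * ((x ᵥ* A) ⬝ᵥ (x ᵥ* B + y ᵥ* Aᵀ⁻¹)) + (w ᵥ* A) ⬝ᵥ (x ᵥ* B + y ᵥ* Aᵀ⁻¹))
      = (-t + 1 / 2 * (x ⬝ᵥ y) + w ⬝ᵥ y) + 1 / 2 * ((w + x) ⬝ᵥ (A * Bᵀ) *ᵥ (w + x)) := by
  have hinv (u : ι → R) : (u ᵥ* A) ⬝ᵥ (y ᵥ* Aᵀ⁻¹) = u ⬝ᵥ y := by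
    rw [← Matrix.transpose_nonsing_inv, Matrix.vecMul_transpose, Matrix.dotProduct_mulVec,
      Matrix.vecMul_vecMul, Matrix.mul_nonsing_inv A hA, Matrix.vecMul_one]
  have hB (u : ι → R) : (u ᵥ* A) ⬝ᵥ (x ᵥ* B) = u ⬝ᵥ (A * Bᵀ) *ᵥ x := by
    rw [← Matrix.mulVec_transpose B, ← Matrix.dotProduct_mulVec, Matrix.mulVec_mulVec]
  have hsymm : x ⬝ᵥ (A * Bᵀ) *ᵥ w = w ⬝ᵥ (A * Bᵀ) *ᵥ x := by
    rw [Matrix.dotProduct_mulVec, ← Matrix.mulVec_transpose, hAB, dotProduct_comm]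
  simp only [dotProduct_add, add_dotProduct, Matrix.mulVec_add, hinv, hB, hsymm]
  ring

/-- Segal–Shale–Weil operator for `g = ((A,B),(0,(Aᵀ)⁻¹))`.
For `A ∈ GL(n,ℝ)` with `ABᵀ` symmetric, the operator
`(R_g f)(w) = |det A|^{1/2} e(½ wABᵀwᵀ) f(wA)` is a unitary operator on `L²(ℝⁿ)`
(it is bijective and preserves the `L²`-norm), and for every `(x,y,t)` in the
Heisenberg group: `R_g(W((x,y,t)^g) f) = W(x,y,t)(R_g f)`, where
`(x,y,t)^g = (xA, xB + y(Aᵀ)⁻¹, t)`. -/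
theorem weil_rep_upper_triangular (n : ℕ) (A B : Matrix (Fin n) (Fin n) ℝ)
    (hA : IsUnit A.det) (hAB : (A * Bᵀ)ᵀ = A * Bᵀ)
    (Rg : ((Fin n → ℝ) → ℂ) → ((Fin n → ℝ) → ℂ))
    (hRg : ∀ f w, Rg f w =
      (Real.sqrt |A.det| : ℂ) * eTwoPi ((1 / 2) * (w ⬝ᵥ (A * Bᵀ).mulVec w)) *
        f (Matrix.vecMul w A)) :
    Function.Bijective Rg ∧
    (∀ f : (Fin n → ℝ) → ℂ, eLpNorm (Rg f) 2 volume = eLpNorm f 2 volume) ∧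
    (∀ (x y : Fin n → ℝ) (t : ℝ) (f : (Fin n → ℝ) → ℂ),
      Rg (schrodingerW (Matrix.vecMul x A)
          (Matrix.vecMul x B + Matrix.vecMul y (Aᵀ)⁻¹) t f) =
        schrodingerW x y t (Rg f)) := by
  have hsqrt : (√|A.det| : ℂ) ≠ 0 := by
    exact_mod_cast (Real.sqrt_pos.mpr (abs_pos.mpr hA.ne_zero)).ne'
  have hbij : Function.Bijective fun w : Fin n → ℝ => w ᵥ* A := by
    have hunit := (Matrix.isUnit_iff_isUnit_det A).mpr hA
    exact ⟨Matrix.vecMul_injective_of_isUnit hunit, Matrix.vecMul_surjective_iff_isUnit.mpr hunit⟩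
  refine ⟨?_, fun f => ?_, fun x y t f => ?_⟩
  · convert bijective_mul_comp
      (fun w => (√|A.det| : ℂ) * eTwoPi (1 / 2 * (w ⬝ᵥ (A * Bᵀ) *ᵥ w)))
      (fun w => mul_ne_zero hsqrt (eTwoPi_ne_zero _)) (Equiv.ofBijective _ hbij) using 1
    funext f w
    exact hRg f w
  · rw [← eLpNorm_two_comp_vecMul A hA f]
    refine eLpNorm_congr_norm_ae (.of_forall fun w => ?_)
    simp [hRg, norm_eTwoPi]
  · funext w
    have hphase := congrArg eTwoPi (intertwining_phase_eq A B hA hAB x y w t)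
    rw [eTwoPi_add (1 / 2 * _), eTwoPi_add (_ + _ + _)] at hphase
    simp only [hRg, schrodingerW, Matrix.add_vecMul]
    linear_combination (√|A.det| : ℂ) * f (w ᵥ* A + x ᵥ* A) * hphase
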